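/- Every point p of ω* (the space of nonprincipal ultrafilters on ω) has an ω^op-like local π-base; in fact, p has a local π-base consisting of pairwise disjoint open sets. Hence the local Noetherian π-type of ω* is ω. -/

import Mathlib

open Cardinal Set

universe u

variable {X : Type u}

/-- `B` is a base for the topology of `X`. -/
def IsBase [TopologicalSpace X] (B : Set (Set X)) : Prop :=
  (∀ U ∈ B, IsOpen U) ∧ ∀ W : Set X, IsOpen W → ∀ p ∈ W, ∃ U ∈ B, p ∈ U ∧ U ⊆ W

/-- `B` is a local base at `p`. -/
def IsLocalBase [TopologicalSpace X] (p : X) (B : Set (Set X)) : Prop :=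
  (∀ U ∈ B, IsOpen U ∧ p ∈ U) ∧ ∀ W : Set X, IsOpen W → p ∈ W → ∃ U ∈ B, U ⊆ W

/-- `B` is a local π-base at `p`. -/
def IsLocalPiBase [TopologicalSpace X] (p : X) (B : Set (Set X)) : Prop :=
  (∀ U ∈ B, IsOpen U ∧ U.Nonempty) ∧ ∀ W : Set X, IsOpen W → p ∈ W → ∃ U ∈ B, U ⊆ W

/-- The weight of `X`: the least infinite cardinal `κ` such that `X` has a base of
cardinality at most `κ`. -/
noncomputable def weight (X : Type u) [TopologicalSpace X] : Cardinal.{u} :=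
  sInf {κ | ℵ₀ ≤ κ ∧ ∃ B : Set (Set X), IsBase B ∧ #B ≤ κ}

/-- The character of `p` in `X`. -/
noncomputable def character [TopologicalSpace X] (p : X) : Cardinal.{u} :=
  sInf {κ | ℵ₀ ≤ κ ∧ ∃ B : Set (Set X), IsLocalBase p B ∧ #B ≤ κ}

/-- The π-character of `p` in `X`. -/
noncomputable def piCharacter [TopologicalSpace X] (p : X) : Cardinal.{u} :=
  sInf {κ | ℵ₀ ≤ κ ∧ ∃ B : Set (Set X), IsLocalPiBase p B ∧ #B ≤ κ}

/-- A family of sets (ordered by `⊆`) is `κ^op`-like if no member is contained in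
`κ`-many members. -/
def IsOpLike {Y : Type u} (B : Set (Set Y)) (κ : Cardinal.{u}) : Prop :=
  ∀ U ∈ B, #{V : Set Y // V ∈ B ∧ U ⊆ V} < κ

/-- The Noetherian type of `X`: the least infinite `κ` such that `X` has a
`κ^op`-like base. -/
noncomputable def Nt (X : Type u) [TopologicalSpace X] : Cardinal.{u} :=
  sInf {κ | ℵ₀ ≤ κ ∧ ∃ B : Set (Set X), IsBase B ∧ IsOpLike B κ}

/-- `⟨F i⟩` is a `⟨#ι, κ⟩`-splitter of `X`: a sequence of finite open covers such
that for every index set `I` of cardinality `κ` and every choice `U i ∈ F i`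
(`i ∈ I`), the interior of `⋂_{i ∈ I} U i` is empty. -/
def IsSplitter [TopologicalSpace X] {ι : Type u} (F : ι → Set (Set X))
    (κ : Cardinal.{u}) : Prop :=
  (∀ i, (F i).Finite ∧ (∀ U ∈ F i, IsOpen U) ∧ ⋃₀ F i = Set.univ) ∧
  ∀ (I : Set ι) (U : ι → Set X), #I = κ → (∀ i ∈ I, U i ∈ F i) →
    interior (⋂ i ∈ I, U i) = ∅

/-- `ω*`: the space of nonprincipal ultrafilters on `ω`. -/
def OmegaStar : Type := {p : Ultrafilter ℕ // ∀ x : Set ℕ, x ∈ p → x.Infinite}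

/-- The Stone topology on `ω*`, generated by the sets `x* = {q : x ∈ q}`. -/
instance : TopologicalSpace OmegaStar :=
  TopologicalSpace.generateFrom {S | ∃ x : Set ℕ, S = {q : OmegaStar | x ∈ q.1}}

namespace BV

/-- almost inclusion -/
def AS (x y : Set ℕ) : Prop := (x \ y).Finite

theorem AS.of_subset {x y : Set ℕ} (h : x ⊆ y) : AS x y := by
  unfold AS; rw [Set.diff_eq_empty.2 h]; exact Set.finite_empty

theorem AS.refl (x : Set ℕ) : AS x x := AS.of_subset subset_rfl

theorem AS.trans {x y z : Set ℕ} (h : AS x y) (h' : AS y z) : AS x z := by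
  refine (Set.Finite.union h h').subset ?_
  intro k hk
  by_cases hy : k ∈ y
  · exact Or.inr ⟨hy, hk.2⟩
  · exact Or.inl ⟨hk.1, hy⟩

theorem AS.inter_inf {x y w : Set ℕ} (h : AS x y) (hi : (x ∩ w).Infinite) : (y ∩ w).Infinite := by
  intro hf
  refine hi ((Set.Finite.union hf h).subset ?_)
  intro k hk
  by_cases hy : k ∈ y
  · exact Or.inl ⟨hy, hk.2⟩
  · exact Or.inr ⟨hk.1, hy⟩

theorem AS.inter {x y z : Set ℕ} (h : AS x y) (h' : AS x z) : AS x (y ∩ z) := by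
  refine (Set.Finite.union h h').subset ?_
  intro k hk
  by_cases hy : k ∈ y
  · exact Or.inr ⟨hk.1, fun hz => hk.2 ⟨hy, hz⟩⟩
  · exact Or.inl ⟨hk.1, hy⟩

/-- general recursion principle -/
theorem exists_rec {X : Type*} {V : Type*} [Nonempty V] (r : X → X → Prop) (wf : WellFounded r)
    (P : X → (X → V) → V → Prop)
    (hP : ∀ y f g v, (∀ y', r y' y → f y' = g y') → P y f v → P y g v)
    (step : ∀ y f, (∀ y', r y' y → P y' f (f y')) → ∃ v, P y f v) :
    ∃ f : X → V, ∀ y, P y f (f y) := by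
  classical
  let d : V := Classical.arbitrary V
  let ext : (y : X) → ((y' : X) → r y' y → V) → X → V :=
    fun y prev y' => if h : r y' y then prev y' h else d
  let F : (y : X) → ((y' : X) → r y' y → V) → V := fun y prev =>
    if h : ∃ v, P y (ext y prev) v then h.choose else d
  let f : X → V := wf.fix F
  have hf : ∀ y, f y = F y (fun y' _ => f y') := fun y => wf.fix_eq F y
  refine ⟨f, fun y => ?_⟩
  induction y using wf.induction with
  | _ y ih =>
    obtain ⟨v, hv⟩ := step y f ih
    have hagree : ∀ y', r y' y → f y' = ext y (fun y' _ => f y') y' := by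
      intro y' h; simp [ext, h]
    have hex : ∃ v, P y (ext y (fun y' _ => f y')) v := ⟨v, hP y _ _ v hagree hv⟩
    have h1 : f y = hex.choose := by
      rw [hf y]; simp only [F]; rw [dif_pos hex]
    rw [h1]
    exact hP y _ _ _ (fun y' h => (hagree y' h).symm) hex.choose_spec

theorem pseudo (x : ℕ → Set ℕ) (hx : ∀ n, x (n+1) ⊆ x n) (hi : ∀ n, (x n).Infinite) :
    ∃ w : Set ℕ, w.Infinite ∧ w ⊆ x 0 ∧ ∀ n, AS w (x n) := by
  obtain ⟨φ, hφ, h⟩ := Filter.extraction_forall_of_frequently (P := fun n k => k ∈ x n)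
    (fun n => Nat.frequently_atTop_iff_infinite.2 (hi n))
  have hanti : Antitone x := antitone_nat_of_succ_le hx
  refine ⟨Set.range φ, Set.infinite_range_of_injective hφ.injective, ?_, ?_⟩
  · rintro _ ⟨n, rfl⟩; exact hanti (Nat.zero_le n) (h n)
  · intro n
    refine ((Set.finite_lt_nat n).image φ).subset ?_
    rintro _ ⟨⟨i, rfl⟩, hi⟩
    refine ⟨i, ?_, rfl⟩
    by_contra hlt
    exact hi (hanti (not_lt.1 hlt) (h i))

theorem split (x : Set ℕ) (hx : x.Infinite) :
    ∃ a b : Set ℕ, a ⊆ x ∧ b ⊆ x ∧ Disjoint a b ∧ a.Infinite ∧ b.Infinite := by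
  let e := hx.natEmbedding
  have hinj : Function.Injective (fun n => (e n : ℕ)) := fun a b h => e.injective (Subtype.ext h)
  refine ⟨Set.range (fun n => (e (2*n) : ℕ)), Set.range (fun n => (e (2*n+1) : ℕ)), ?_, ?_, ?_, ?_, ?_⟩
  · rintro _ ⟨n, rfl⟩; exact (e _).2
  · rintro _ ⟨n, rfl⟩; exact (e _).2
  · rw [Set.disjoint_left]
    rintro _ ⟨n, rfl⟩ ⟨m, hm⟩
    have := hinj hm
    omega
  · apply Set.infinite_range_of_injective
    intro a b h
    have := hinj h
    omega
  · apply Set.infinite_range_of_injective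
    intro a b h
    have := hinj h
    omega

/-- dense open families of infinite sets -/
structure DO (D : Set (Set ℕ)) : Prop where
  inf : ∀ x ∈ D, x.Infinite
  opn : ∀ x ∈ D, ∀ z : Set ℕ, z.Infinite → AS z x → z ∈ D
  dense : ∀ x : Set ℕ, x.Infinite → ∃ z ⊆ x, z ∈ D

theorem DO.pull {D : Set (Set ℕ)} (hD : DO D) (φ : ℕ → ℕ) (hφ : Function.Injective φ) :
    DO {y | φ '' y ∈ D} where
  inf x hx := Set.Infinite.of_image φ (hD.inf _ hx)
  opn x hx z hz h := by
    refine hD.opn _ hx _ (hz.image hφ.injOn) ?_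
    refine (Set.Finite.image φ h).subset ?_
    rw [Set.image_diff hφ]
  dense x hx := by
    obtain ⟨z, hz, hzD⟩ := hD.dense _ (hx.image hφ.injOn)
    refine ⟨φ ⁻¹' z, ?_, ?_⟩
    · intro k hk
      obtain ⟨j, hj, hjk⟩ := hz hk
      rwa [← hφ hjk]
    · have : φ '' (φ ⁻¹' z) = z := by
        rw [Set.image_preimage_eq_iff]
        exact hz.trans (Set.image_subset_range _ _)
      simpa [this] using hzD

theorem countable_inter (D : ℕ → Set (Set ℕ)) (hD : ∀ n, DO (D n)) : ∃ x : Set ℕ, x.Infinite ∧ ∀ n, x ∈ D n := by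
  choose! z hz hzD using fun n => (hD n).dense
  let x : ℕ → Set ℕ := fun n => Nat.rec Set.univ (fun n y => z n y) n
  have hi : ∀ n, (x n).Infinite := by
    intro n
    induction n with
    | zero => exact Set.infinite_univ
    | succ n ih => exact (hD n).inf _ (hzD n _ ih)
  obtain ⟨w, hw, -, h⟩ := pseudo x (fun n => hz n _ (hi n)) hi
  exact ⟨w, hw, fun n => (hD n).opn _ (hzD n _ (hi n)) w hw (h (n+1))⟩

/-- maximal almost disjoint family inside a dense open family -/
theorem exists_mad (D : Set (Set ℕ)) (hD : DO D) : ∃ M : Set (Set ℕ), M ⊆ D ∧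
    (∀ a ∈ M, ∀ b ∈ M, a ≠ b → (a ∩ b).Finite) ∧
    ∀ x : Set ℕ, x.Infinite → ∃ a ∈ M, (x ∩ a).Infinite := by
  obtain ⟨M, hM⟩ := zorn_subset {M : Set (Set ℕ) | M ⊆ D ∧ ∀ a ∈ M, ∀ b ∈ M, a ≠ b → (a ∩ b).Finite} (by
    intro c hc hch
    refine ⟨⋃₀ c, ⟨Set.sUnion_subset fun s hs => (hc hs).1, ?_⟩, fun s hs => Set.subset_sUnion_of_mem hs⟩
    rintro a ⟨s, hs, has⟩ b ⟨t, ht, hbt⟩ hab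
    rcases hch.total hs ht with h | h
    · exact (hc ht).2 a (h has) b hbt hab
    · exact (hc hs).2 a has b (h hbt) hab)
  refine ⟨M, hM.prop.1, hM.prop.2, fun x hx => ?_⟩
  obtain ⟨z, hz, hzD⟩ := hD.dense x hx
  by_contra! hcon
  have hzi := hD.inf z hzD
  have hfin : ∀ a ∈ M, (z ∩ a).Finite := fun a ha =>
    (hcon a ha).subset (Set.inter_subset_inter_left _ hz)
  have hins : insert z M ∈ {M : Set (Set ℕ) | M ⊆ D ∧ ∀ a ∈ M, ∀ b ∈ M, a ≠ b → (a ∩ b).Finite} := by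
    refine ⟨Set.insert_subset hzD hM.prop.1, ?_⟩
    rintro a (rfl | ha) b (rfl | hb) hab
    · exact absurd rfl hab
    · exact hfin b hb
    · rw [Set.inter_comm]; exact hfin a ha
    · exact hM.prop.2 a ha b hb hab
  have hzM : z ∈ M := hM.le_of_ge hins (Set.subset_insert z M) (Set.mem_insert z M)
  have := hfin z hzM
  rw [Set.inter_self] at this
  exact hzi this

theorem DO_gap (g : ℕ → ℕ) :
    DO {x | x.Infinite ∧ ∃ N, ∀ m ∈ x, ∀ k ∈ x, N ≤ m → m < k → g m < k} where
  inf x hx := hx.1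
  opn := by
    rintro x ⟨hx, N, hN⟩ z hz h
    obtain ⟨B, hB⟩ := h.bddAbove
    refine ⟨hz, max N (B+1), fun m hm k hk hNm hmk => ?_⟩
    have hmem : ∀ j ∈ z, B < j → j ∈ x := by
      intro j hj hBj
      by_contra hjx
      have := hB ⟨hj, hjx⟩
      omega
    exact hN m (hmem m hm (by omega)) k (hmem k hk (by omega)) (by omega) hmk
  dense x hx := by
    choose nxt hn hlt using fun m => hx.exists_gt (max m (g m))
    let φ : ℕ → ℕ := fun n => Nat.rec (nxt 0) (fun _ m => nxt m) n
    have hs : ∀ n, φ (n+1) = nxt (φ n) := fun n => rfl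
    have hmono : StrictMono φ := strictMono_nat_of_lt_succ fun n => by
      rw [hs]; exact lt_of_le_of_lt (le_max_left _ _) (hlt _)
    refine ⟨Set.range φ, ?_, Set.infinite_range_of_injective hmono.injective, 0, ?_⟩
    · rintro _ ⟨n, rfl⟩
      cases n with
      | zero => exact hn 0
      | succ n => exact hn _
    · rintro _ ⟨i, rfl⟩ _ ⟨j, rfl⟩ - hij
      have : i < j := hmono.lt_iff_lt.1 hij
      have h1 : φ (i+1) ≤ φ j := hmono.monotone this
      rw [hs] at h1
      exact lt_of_lt_of_le (lt_of_le_of_lt (le_max_right _ _) (hlt _)) h1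

theorem DO_not_above (x : Set ℕ) (hx : x.Infinite) : DO {z | z.Infinite ∧ ¬ AS x z} where
  inf z hz := hz.1
  opn z hz w hw h := ⟨hw, fun h' => hz.2 (h'.trans h)⟩
  dense z hz := by
    obtain ⟨a, b, ha, hb, hab, hai, hbi⟩ := split z hz
    by_cases h : AS x a
    · refine ⟨b, hb, hbi, fun h' => hx ?_⟩
      have := h.inter h'
      rw [Set.disjoint_iff_inter_eq_empty.1 hab] at this
      simpa [AS] using this
    · exact ⟨a, ha, hai, h⟩

theorem DO_inf : DO {z | z.Infinite} where
  inf z hz := hz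
  opn z hz w hw h := hw
  dense z hz := ⟨z, subset_rfl, hz⟩

theorem exists_matrix : ∃ (κ : Ordinal.{0}) (A : Ordinal.{0} → Set (Set ℕ)),
    (∀ α < κ, ∀ a ∈ A α, ∀ b ∈ A α, a ≠ b → (a ∩ b).Finite) ∧
    (∀ α < κ, ∀ x : Set ℕ, x.Infinite → ∃ a ∈ A α, (x ∩ a).Infinite) ∧
    (∀ β α, β < α → α < κ → ∀ a ∈ A α, ∃ b ∈ A β, AS a b) ∧
    (∀ x : Set ℕ, x.Infinite → ∃ α < κ, ∀ a ∈ A α, ¬ AS x a) ∧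
    (∀ α < κ, ∀ g : Ordinal.{0} → ℕ → ℕ, ∃ h : ℕ → ℕ, ∀ β < α, ∃ N, ∀ n ≥ N, g β n ≤ h n) ∧
    (∀ s : ℕ → Ordinal.{0}, (∀ n, s n < κ) → ∃ δ < κ, ∀ n, s n ≤ δ) ∧
    (∀ α < κ, ∀ a ∈ A α, a.Infinite) := by
  classical
  let S : Set Ordinal.{0} := {o | ∃ D : Ordinal.{0} → Set (Set ℕ), (∀ β, DO (D β)) ∧
    ¬ ∃ x : Set ℕ, x.Infinite ∧ ∀ β < o, x ∈ D β}
  have hS : S.Nonempty := by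
    let t : Set ℕ → Ordinal.{0} := Ordinal.typein (WellOrderingRel (α := Set ℕ))
    refine ⟨Ordinal.type (WellOrderingRel (α := Set ℕ)), fun β =>
      if h : ∃ x : Set ℕ, x.Infinite ∧ t x = β then {z | z.Infinite ∧ ¬ AS h.choose z}
      else {z | z.Infinite}, fun β => ?_, ?_⟩
    · by_cases h : ∃ x : Set ℕ, x.Infinite ∧ t x = β
      · simp only [dif_pos h]; exact DO_not_above _ h.choose_spec.1
      · simp only [dif_neg h]; exact DO_inf
    · rintro ⟨x, hx, hall⟩
      have h : ∃ y : Set ℕ, y.Infinite ∧ t y = t x := ⟨x, hx, rfl⟩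
      have h1 := hall (t x) (Ordinal.typein_lt_type _ x)
      beta_reduce at h1
      rw [dif_pos h] at h1
      have h2 : h.choose = x := Ordinal.typein_injective _ h.choose_spec.2
      rw [h2] at h1
      exact h1.2 (AS.refl x)
  let κ := sInf S
  obtain ⟨D, hD, hDe⟩ : κ ∈ S := csInf_mem hS
  have hmin : ∀ α < κ, ∀ D : Ordinal.{0} → Set (Set ℕ), (∀ β, DO (D β)) →
      ∃ x : Set ℕ, x.Infinite ∧ ∀ β < α, x ∈ D β := by
    intro α hα D hD
    by_contra h
    exact notMem_of_lt_csInf' hα ⟨D, hD, h⟩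
  have hdense : ∀ α < κ, ∀ D : Ordinal.{0} → Set (Set ℕ), (∀ β, DO (D β)) →
      ∀ x : Set ℕ, x.Infinite → ∃ z ⊆ x, z.Infinite ∧ ∀ β < α, z ∈ D β := by
    intro α hα D hD x hx
    let e := hx.natEmbedding
    have hinj : Function.Injective (fun n => (e n : ℕ)) := fun a b h => e.injective (Subtype.ext h)
    obtain ⟨y, hy, hall⟩ := hmin α hα _ (fun β => (hD β).pull _ hinj)
    refine ⟨_, ?_, hy.image hinj.injOn, hall⟩
    rintro _ ⟨n, -, rfl⟩
    exact (e n).2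
  -- the matrix
  let E : Ordinal.{0} → (Ordinal.{0} → Set (Set ℕ)) → Set (Set ℕ) := fun α A =>
    {x | x ∈ D α ∧ ∀ β < α, ∃ a ∈ A β, AS x a}
  obtain ⟨A, hA⟩ := exists_rec (V := Set (Set ℕ)) (fun a b : Ordinal.{0} => a < b) Ordinal.lt_wf
    (fun α A M => α < κ → M ⊆ E α A ∧ (∀ a ∈ M, ∀ b ∈ M, a ≠ b → (a ∩ b).Finite) ∧
      ∀ x : Set ℕ, x.Infinite → ∃ a ∈ M, (x ∩ a).Infinite) (by
      intro y f g v hfg h hy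
      have : E y f = E y g := by
        ext x
        simp only [E, Set.mem_setOf_eq]
        refine and_congr_right fun _ => forall₂_congr fun β hβ => by rw [hfg β hβ]
      rw [← this]; exact h hy) (by
      intro α A ih
      by_cases hα : α < κ
      swap
      · exact ⟨∅, fun h => absurd h hα⟩
      have hE : DO (E α A) := by
        refine ⟨fun x hx => (hD α).inf x hx.1, ?_, ?_⟩
        · rintro x ⟨hx, hx'⟩ z hz hzx
          refine ⟨(hD α).opn x hx z hz hzx, fun β hβ => ?_⟩
          obtain ⟨a, ha, h⟩ := hx' β hβ
          exact ⟨a, ha, hzx.trans h⟩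
        · intro x hx
          obtain ⟨z, hz, hzi, hall⟩ := hdense α hα (fun β => if β < α then
            {x | x.Infinite ∧ ∃ a ∈ A β, AS x a} else {z | z.Infinite}) (by
              intro β
              by_cases hβ : β < α
              swap
              · simp only [if_neg hβ]; exact DO_inf
              simp only [if_pos hβ]
              refine ⟨fun x hx => hx.1, ?_, ?_⟩
              · rintro x ⟨hx, a, ha, h⟩ z hz hzx
                exact ⟨hz, a, ha, hzx.trans h⟩
              · intro x hx
                obtain ⟨a, ha, h⟩ := (ih β hβ (hβ.trans hα)).2.2 x hx
                exact ⟨x ∩ a, Set.inter_subset_left, h, a, ha, AS.of_subset Set.inter_subset_right⟩)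
            x hx
          obtain ⟨w, hw, hwD⟩ := (hD α).dense z hzi
          refine ⟨w, hw.trans hz, hwD, fun β hβ => ?_⟩
          have := hall β hβ
          rw [if_pos hβ] at this
          obtain ⟨-, a, ha, h⟩ := this
          exact ⟨a, ha, (AS.of_subset hw).trans h⟩
      obtain ⟨M, h1, h2, h3⟩ := exists_mad _ hE
      exact ⟨M, fun _ => ⟨h1, h2, h3⟩⟩)
  refine ⟨κ, A, fun α hα => (hA α hα).2.1, fun α hα => (hA α hα).2.2, ?_, ?_, ?_, ?_, ?_⟩
  · intro β α hβ hα a ha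
    exact ((hA α hα).1 ha).2 β hβ
  · intro x hx
    by_contra! hcon
    refine hDe ⟨x, hx, fun β hβ => ?_⟩
    obtain ⟨a, ha, h⟩ := hcon β hβ
    exact (hD β).opn a ((hA β hβ).1 ha).1 x hx h
  · intro α hα g
    obtain ⟨x, hx, hall⟩ := hmin α hα _ (fun β => DO_gap (fun n => partialSups (g β) n))
    choose n1 h1 h1' using fun n => hx.exists_gt n
    refine ⟨fun n => n1 (n1 n), fun β hβ => ?_⟩
    obtain ⟨-, N, hN⟩ := hall β hβ
    refine ⟨N, fun n hn => ?_⟩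
    have h2 := hN (n1 n) (h1 n) (n1 (n1 n)) (h1 _) (le_trans hn (h1' n).le) (h1' _)
    have h3 : g β n ≤ partialSups (g β) n := le_partialSups _ _
    have h4 : partialSups (g β) n ≤ partialSups (g β) (n1 n) := (partialSups (g β)).monotone (h1' n).le
    exact (h3.trans h4).trans h2.le
  · intro s hs
    by_contra! hcon
    have hDn : ∀ n, DO {x | x.Infinite ∧ ∀ β < s n, x ∈ D β} := by
      intro n
      refine ⟨fun x hx => hx.1, ?_, ?_⟩
      · rintro x ⟨hx, hx'⟩ z hz hzx
        exact ⟨hz, fun β hβ => (hD β).opn x (hx' β hβ) z hz hzx⟩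
      · intro x hx
        obtain ⟨z, hz, hzi, h⟩ := hdense (s n) (hs n) D hD x hx
        exact ⟨z, hz, hzi, h⟩
    obtain ⟨x, hx, hall⟩ := countable_inter _ hDn
    refine hDe ⟨x, hx, fun β hβ => ?_⟩
    obtain ⟨n, hn⟩ := hcon β hβ
    exact (hall n).2 β hn
  · intro α hα a ha
    exact (hD α).inf a ((hA α hα).1 ha).1
/-- base matrix -/
structure Mx (κ : Ordinal.{0}) (A : Ordinal.{0} → Set (Set ℕ)) : Prop where
  ad : ∀ α < κ, ∀ a ∈ A α, ∀ b ∈ A α, a ≠ b → (a ∩ b).Finite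
  hit : ∀ α < κ, ∀ x : Set ℕ, x.Infinite → ∃ a ∈ A α, (x ∩ a).Infinite
  up : ∀ β α, β < α → α < κ → ∀ a ∈ A α, ∃ b ∈ A β, AS a b
  dense : ∀ x : Set ℕ, x.Infinite → ∃ α < κ, ∀ a ∈ A α, ¬ AS x a
  dom : ∀ α < κ, ∀ g : Ordinal.{0} → ℕ → ℕ, ∃ h : ℕ → ℕ, ∀ β < α, ∃ N, ∀ n ≥ N, g β n ≤ h n
  cof : ∀ s : ℕ → Ordinal.{0}, (∀ n, s n < κ) → ∃ δ < κ, ∀ n, s n ≤ δ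
  inf : ∀ α < κ, ∀ a ∈ A α, a.Infinite

theorem exists_mx : ∃ κ A, Mx κ A := by
  obtain ⟨κ, A, h1, h2, h3, h4, h5, h6, h7⟩ := exists_matrix
  exact ⟨κ, A, h1, h2, h3, h4, h5, h6, h7⟩

theorem AS.finite {x y : Set ℕ} (h : AS x y) (hy : y.Finite) : x.Finite :=
  (Set.Finite.union h hy).subset fun k hk => by
    by_cases h : k ∈ y
    · exact Or.inr h
    · exact Or.inl ⟨hk, h⟩

theorem Mx.up_le {κ A} (M : Mx κ A) {α δ : Ordinal.{0}} (h : α ≤ δ) (hδ : δ < κ) {τ : Set ℕ}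
    (hτ : τ ∈ A δ) : ∃ b ∈ A α, AS τ b := by
  rcases h.eq_or_lt with rfl | h
  · exact ⟨τ, hτ, AS.refl _⟩
  · exact M.up _ _ h hδ _ hτ

theorem Mx.as_of_hit {κ A} (M : Mx κ A) {α δ : Ordinal.{0}} (h : α ≤ δ) (hδ : δ < κ) {τ a : Set ℕ}
    (hτ : τ ∈ A δ) (ha : a ∈ A α) (hx : (τ ∩ a).Infinite) : AS τ a := by
  obtain ⟨b, hb, hab⟩ := M.up_le h hδ hτ
  have : b = a := by
    by_contra hne
    exact hab.inter_inf hx (M.ad α (h.trans_lt hδ) b hb a ha hne)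
  exact this ▸ hab

theorem Mx.child {κ A} (M : Mx κ A) (x : {x : Set ℕ // x.Infinite}) :
    ∃ (α : Ordinal.{0}) (a : Bool → Set ℕ), α < κ ∧ (∀ b, a b ∈ A α) ∧ (∀ b, (x.1 ∩ a b).Infinite) ∧
      a true ≠ a false := by
  obtain ⟨x, hx⟩ := x
  obtain ⟨α, hα, h⟩ := M.dense x hx
  obtain ⟨a, ha, hxa⟩ := M.hit α hα x hx
  obtain ⟨a', ha', hxa'⟩ := M.hit α hα (x \ a) (h a ha)
  refine ⟨α, fun b => if b then a else a', hα, ?_, ?_, ?_⟩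
  · rintro (_ | _) <;> simpa
  · rintro (_ | _)
    · simpa using hxa'.mono (Set.inter_subset_inter_left _ Set.diff_subset)
    · simpa using hxa
  · simp only [if_true]
    intro he
    simp at he
    subst he
    apply hxa'
    convert Set.finite_empty
    ext k; simp

theorem Mx.many {κ A} (M : Mx κ A) (D : Set ℕ) (hD : D.Infinite) :
    ∃ δ < κ, ∃ σ : (ℕ → Bool) → Set ℕ, Function.Injective σ ∧ ∀ f, σ f ∈ A δ ∧ (σ f ∩ D).Infinite := by
  classical
  choose al a hal ha hai hane using M.child
  let node : List Bool → {x : Set ℕ // x.Infinite} := fun l =>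
    List.rec ⟨D, hD⟩ (fun b _ x => ⟨x.1 ∩ a x b, hai x b⟩) l
  have node_cons : ∀ b l, (node (b :: l)).1 = (node l).1 ∩ a (node l) b := fun b l => rfl
  let br : (ℕ → Bool) → ℕ → List Bool := fun f n => Nat.rec [] (fun k l => f k :: l) n
  have br_succ : ∀ f n, br f (n+1) = f n :: br f n := fun f n => rfl
  obtain ⟨s, hs⟩ := exists_surjective_nat (List Bool)
  obtain ⟨δ, hδ, hsd⟩ := M.cof (fun n => al (node (s n))) (fun n => hal _)
  have hle : ∀ l, al (node l) ≤ δ := fun l => by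
    obtain ⟨n, rfl⟩ := hs l; exact hsd n
  have hpf : ∀ f : ℕ → Bool, ∃ w : Set ℕ, w.Infinite ∧ w ⊆ D ∧ ∀ n, AS w (node (br f n)).1 := by
    intro f
    exact pseudo (fun n => (node (br f n)).1)
      (fun n => by simp only [br_succ, node_cons]; exact Set.inter_subset_left) (fun n => (node _).2)
  choose w hwi hwD hwn using hpf
  choose σ hσ hσw using fun f => M.hit δ hδ (w f) (hwi f)
  have hin : ∀ f n, AS (σ f) (a (node (br f n)) (f n)) := by
    intro f n
    refine M.as_of_hit (hle (br f n)) hδ (hσ f) (ha _ _) ?_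
    rw [Set.inter_comm]
    refine AS.inter_inf ?_ (hσw f)
    refine (hwn f (n+1)).trans (AS.of_subset ?_)
    rw [br_succ, node_cons]; exact Set.inter_subset_right
  refine ⟨δ, hδ, σ, ?_, fun f => ⟨hσ f, ?_⟩⟩
  · intro f g hfg
    by_contra hne
    have hex : ∃ n, f n ≠ g n := by
      by_contra! h; exact hne (funext h)
    let n := Nat.find hex
    have hn : f n ≠ g n := Nat.find_spec hex
    have hlt : ∀ m < n, f m = g m := fun m hm => by
      by_contra h; exact Nat.find_min hex hm h
    have hbr : ∀ m ≤ n, br f m = br g m := by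
      intro m
      induction m with
      | zero => intro _; rfl
      | succ m ih => intro hm; rw [br_succ, br_succ, ih (by omega), hlt m (by omega)]
    have h1 := hin f n
    have h2 := hin g n
    rw [← hfg, ← hbr n le_rfl] at h2
    have hanb : a (node (br f n)) (f n) ≠ a (node (br f n)) (g n) := by
      have := hane (node (br f n))
      revert hn
      cases f n <;> cases g n <;> simp [this, this.symm]
    exact M.inf δ hδ _ (hσ f) ((h1.inter h2).finite
      (M.ad _ (hal _) _ (ha _ _) _ (ha _ _) hanb))
  · rw [Set.inter_comm]; exact (hσw f).mono (Set.inter_subset_inter_left _ (hwD f))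

theorem exists_order : ∃ (r : Set ℕ → Set ℕ → Prop), IsWellOrder (Set ℕ) r ∧
    ∀ y, #{y' // r y' y} < #(ℕ → Bool) := by
  obtain ⟨r, wo, h⟩ := Cardinal.exists_ord_eq (Set ℕ)
  refine ⟨r, wo, fun y => ?_⟩
  have h1 := Cardinal.card_typein_lt y h
  rw [Ordinal.card_typein] at h1
  refine h1.trans_eq ?_
  simp

theorem lemQ (c : ℕ → Set ℕ) (hc : ∀ i j, i ≠ j → Disjoint (c i) (c j)) :
    ∃ N : Set (Set ℕ), (∀ z ∈ N, z.Infinite ∧ z ⊆ (⋃ i, c i) ∧ ∀ i, (z ∩ c i).Finite) ∧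
      (∀ z ∈ N, ∀ z' ∈ N, z ≠ z' → (z ∩ z').Finite) ∧
      ∀ y : Set ℕ, {i | (y ∩ c i).Infinite}.Infinite → ∃ z ∈ N, z ⊆ y := by
  classical
  obtain ⟨κ, A, M⟩ := exists_mx
  obtain ⟨r, wo, hr⟩ := exists_order
  let F : Set ℕ → Prop := fun y => {i | (y ∩ c i).Infinite}.Infinite
  let P : Set ℕ → (Set ℕ → Ordinal.{0} × Set ℕ × Set ℕ) → Ordinal.{0} × Set ℕ × Set ℕ → Prop :=
    fun y f v => F y → (v.1 < κ ∧ v.2.1 ∈ A v.1 ∧ v.2.2.Infinite ∧ v.2.2 ⊆ y ∧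
      (v.2.2 ⊆ ⋃ i ∈ v.2.1, c i) ∧ (∀ i, (v.2.2 ∩ c i).Finite) ∧
      ∀ y', r y' y → F y' → (v.2.2 ∩ (f y').2.2).Finite ∧
        ¬ (v.1 ≤ (f y').1 ∧ AS (f y').2.1 v.2.1))
  have main : ∃ f, ∀ y, P y f (f y) := by
    refine exists_rec r wo.wf P ?_ ?_
    · intro y f g v hfg h hF
      obtain ⟨h1, h2, h3, h4, h5, h6, h7⟩ := h hF
      refine ⟨h1, h2, h3, h4, h5, h6, fun y' hy' hF' => ?_⟩
      rw [← hfg y' hy']; exact h7 y' hy' hF'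
    · intro y f ih
      by_cases hF : F y
      swap
      · exact ⟨(0, ∅, ∅), fun h => absurd h hF⟩
      obtain ⟨α, hα, S, hSinj, hS⟩ := M.many _ hF
      have hpick : ∃ t, ∀ y', r y' y → F y' → ¬ (α ≤ (f y').1 ∧ AS (f y').2.1 (S t)) := by
        by_contra! hcon
        choose e he1 he2 he3 he4 using hcon
        have : Function.Injective (fun t => (⟨e t, he1 t⟩ : {y' // r y' y})) := by
          intro t t' htt
          have htt : e t = e t' := congrArg Subtype.val htt
          by_contra hne
          obtain ⟨k1, k2, -⟩ := ih _ (he1 t) (he2 t)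
          have q1 := he4 t
          have q2 := he4 t'
          rw [← htt] at q2
          exact M.inf _ k1 _ k2 ((q1.inter q2).finite
            (M.ad α hα _ (hS t).1 _ (hS t').1 (fun h => hne (hSinj h))))
        exact absurd (Cardinal.mk_le_of_injective this) (not_le.2 (hr y))
      obtain ⟨t, ht⟩ := hpick
      obtain ⟨hσ, hσi⟩ := hS t
      generalize S t = σ at ht hσ hσi
      have hg : ∀ β, ∃ g : ℕ → ℕ, β < α → ∀ y', r y' y → F y' → (f y').1 = β → AS σ (f y').2.1 →
          ∀ i, ∀ k ∈ (f y').2.2 ∩ c i, k ≤ g i := by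
        intro β
        by_cases hex : ∃ y', r y' y ∧ F y' ∧ (f y').1 = β ∧ AS σ (f y').2.1
        · obtain ⟨y1, hy1, hF1, hb1, hs1⟩ := hex
          obtain ⟨m1, m2, -, -, -, m6, m7⟩ := ih y1 hy1 hF1
          choose g hg using fun i => (m6 i).bddAbove
          refine ⟨g, fun hβ y2 hy2 hF2 hb2 hs2 i k hk => ?_⟩
          obtain ⟨n1, n2, -, -, -, n6, n7⟩ := ih y2 hy2 hF2
          have hss : (f y1).2.1 = (f y2).2.1 := by
            by_contra hne
            have := M.ad β (hβ.trans hα) _ (hb1 ▸ m2) _ (hb2 ▸ n2) hne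
            exact M.inf α hα _ hσ ((hs1.inter hs2).finite this)
          have hyy : y1 = y2 := by
            rcases trichotomous_of r y1 y2 with h | h | h
            · exact absurd ⟨by rw [hb1, hb2], by rw [hss]; exact AS.refl _⟩ (n7 y1 h hF1).2
            · exact h
            · exact absurd ⟨by rw [hb1, hb2], by rw [hss]; exact AS.refl _⟩ (m7 y2 h hF2).2
          subst hyy
          exact hg i hk
        · push Not at hex
          exact ⟨0, fun _ y' h1 h2 h3 h4 => absurd h4 (hex y' h1 h2 h3)⟩
      choose g hg using hg
      obtain ⟨h, hh⟩ := M.dom α hα g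
      have hpt : ∀ i, ∃ k, (y ∩ c i).Infinite → k ∈ y ∩ c i ∧ h i < k := by
        intro i
        by_cases hi : (y ∩ c i).Infinite
        · obtain ⟨k, hk, hlt⟩ := hi.exists_gt (h i)
          exact ⟨k, fun _ => ⟨hk, hlt⟩⟩
        · exact ⟨0, fun h => absurd h hi⟩
      choose pt hpt using hpt
      have hdis : ∀ i j k, k ∈ c i → k ∈ c j → i = j := by
        intro i j k hi hj
        by_contra hne
        exact Set.disjoint_left.1 (hc i j hne) hi hj
      let I := σ ∩ {i | (y ∩ c i).Infinite}
      refine ⟨(α, σ, pt '' I), fun _ => ⟨hα, hσ, ?_, ?_, ?_, ?_, ?_⟩⟩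
      · refine Set.Infinite.image ?_ hσi
        intro i hi j hj hij
        exact hdis i j (pt i) (hpt i hi.2).1.2 (hij ▸ (hpt j hj.2).1.2)
      · rintro _ ⟨i, hi, rfl⟩; exact (hpt i hi.2).1.1
      · rintro _ ⟨i, hi, rfl⟩
        exact Set.mem_biUnion hi.1 (hpt i hi.2).1.2
      · intro i
        refine (Set.finite_singleton (pt i)).subset ?_
        rintro _ ⟨⟨j, hj, rfl⟩, hji⟩
        have := hdis j i _ (hpt j hj.2).1.2 hji
        rw [this]; rfl
      · intro y' hy' hF'
        refine ⟨?_, ht y' hy' hF'⟩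
        obtain ⟨m1, m2, m3, m4, m5, m6, m7⟩ := ih y' hy' hF'
        by_cases hfin : (σ ∩ (f y').2.1).Finite
        · refine (hfin.image pt).subset ?_
          rintro _ ⟨⟨i, hi, rfl⟩, hz⟩
          refine ⟨i, ⟨hi.1, ?_⟩, rfl⟩
          have hz := m5 hz
          simp only [Set.mem_iUnion] at hz
          obtain ⟨j, hj, hjc⟩ := hz
          rwa [hdis i j _ (hpt i hi.2).1.2 hjc]
        · have hlt : (f y').1 < α := by
            by_contra hle
            refine ht y' hy' hF' ⟨not_lt.1 hle, M.as_of_hit (not_lt.1 hle) m1 m2 hσ ?_⟩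
            rw [Set.inter_comm]; exact hfin
          have has := M.as_of_hit hlt.le hα hσ m2 hfin
          obtain ⟨N, hN⟩ := hh _ hlt
          refine ((Set.finite_lt_nat N).image pt).subset ?_
          rintro _ ⟨⟨i, hi, rfl⟩, hz⟩
          refine ⟨i, ?_, rfl⟩
          by_contra hle
          have h1 := hN i (not_lt.1 hle)
          have h2 := hg _ hlt y' hy' hF' rfl has i (pt i) ⟨hz, (hpt i hi.2).1.2⟩
          have h3 := (hpt i hi.2).2
          omega
  obtain ⟨f, hf⟩ := main
  refine ⟨{z | ∃ y, F y ∧ z = (f y).2.2}, ?_, ?_, ?_⟩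
  · rintro _ ⟨y, hF, rfl⟩
    obtain ⟨m1, m2, m3, m4, m5, m6, m7⟩ := hf y hF
    refine ⟨m3, m5.trans ?_, m6⟩
    exact Set.iUnion₂_subset_iUnion _ _
  · rintro _ ⟨y, hF, rfl⟩ _ ⟨y', hF', rfl⟩ hne
    rcases trichotomous_of r y y' with h | h | h
    · rw [Set.inter_comm]
      exact ((hf y' hF').2.2.2.2.2.2 y h hF).1
    · subst h; exact absurd rfl hne
    · exact ((hf y hF).2.2.2.2.2.2 y' h hF').1
  · intro y hF
    exact ⟨_, ⟨y, hF, rfl⟩, (hf y hF).2.2.2.1⟩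

theorem last_col (E : ℕ → Set ℕ) (hE : Antitone E) (n m j : ℕ) (h1 : j ∈ E n) (h2 : j ∉ E m) :
    ∃ i, n ≤ i ∧ i < m ∧ j ∈ E i ∧ j ∉ E (i+1) := by
  induction m with
  | zero => exact absurd (hE (Nat.zero_le n) h1) h2
  | succ m ih =>
    by_cases h : j ∈ E m
    · refine ⟨m, ?_, Nat.lt_succ_self m, h, h2⟩
      by_contra hlt
      exact h2 (hE (by omega) h1)
    · obtain ⟨i, a1, a2, a3⟩ := ih h
      exact ⟨i, a1, by omega, a3⟩

/-- the initial cut generated by a sequence -/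
def cut (r : Set ℕ → Set ℕ → Prop) (G : Set ℕ → Prop) (e : ℕ → Set ℕ) : Set (Set ℕ) :=
  {u | G u ∧ ∃ n, r u (e n)}

/-- `e` is an increasing sequence in the tower -/
def Chain (r : Set ℕ → Set ℕ → Prop) (G : Set ℕ → Prop) (e : ℕ → Set ℕ) : Prop :=
  ∀ n, G (e n) ∧ r (e n) (e (n+1))

theorem lemCut (r : Set ℕ → Set ℕ → Prop) (wo : IsWellOrder (Set ℕ) r) (G : Set ℕ → Prop)
    (hG : ∀ x y, G x → G y → r x y → AS y x) (C : Set (Set ℕ))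
    (hC : ∃ e, Chain r G e ∧ cut r G e = C) :
    ∃ N : Set (Set ℕ), (∀ z ∈ N, z.Infinite) ∧
      (∀ z ∈ N, ∀ z' ∈ N, z ≠ z' → (z ∩ z').Finite) ∧
      (∀ z ∈ N, ∀ u ∈ C, AS z u) ∧
      (∀ z ∈ N, ∀ v, G v → v ∉ C → (z ∩ v).Finite) ∧
      ∀ y γ, Chain r G γ → cut r G γ = C → (∀ n, ((y ∩ γ n) \ γ (n+1)).Infinite) →
        ∃ z ∈ N, z ⊆ y := by
  classical
  obtain ⟨e, he, rfl⟩ := hC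
  have hV : ∃ V : Set ℕ, (∀ v, G v → v ∉ cut r G e → AS v V) ∧ ∀ j, AS V (e j) := by
    by_cases hex : {v | G v ∧ v ∉ cut r G e}.Nonempty
    · obtain ⟨V, ⟨hV1, hV2⟩, hmin⟩ := wo.wf.has_min _ hex
      refine ⟨V, fun v hv hvC => ?_, fun j => ?_⟩
      · rcases trichotomous_of r v V with h | h | h
        · exact absurd h (hmin v ⟨hv, hvC⟩)
        · rw [h]; exact AS.refl _
        · exact hG _ _ hV1 hv h
      · rcases trichotomous_of r V (e j) with h | h | h
        · exact absurd ⟨hV1, j, h⟩ hV2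
        · exact absurd ⟨hV1, j+1, h ▸ (he j).2⟩ hV2
        · exact hG _ _ (he j).1 hV1 h
    · refine ⟨∅, fun v h1 h2 => absurd ⟨v, h1, h2⟩ hex, fun j => AS.of_subset (Set.empty_subset _)⟩
  obtain ⟨V, hV1, hV2⟩ := hV
  let E : ℕ → Set ℕ := fun n => Nat.rec (e 0) (fun k x => x ∩ e (k+1)) n
  have E_succ : ∀ n, E (n+1) = E n ∩ e (n+1) := fun n => rfl
  have hanti : Antitone E := antitone_nat_of_succ_le fun n => by
    rw [E_succ]; exact Set.inter_subset_left
  have hEe : ∀ n, E n ⊆ e n := by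
    intro n
    cases n with
    | zero => exact subset_rfl
    | succ n => rw [E_succ]; exact Set.inter_subset_right
  have heE : ∀ n, AS (e n) (E n) := by
    intro n
    induction n with
    | zero => exact AS.refl _
    | succ n ih =>
      rw [E_succ]
      exact ((hG _ _ (he n).1 (he (n+1)).1 (he n).2).trans ih).inter (AS.refl _)
  let c : ℕ → Set ℕ := fun i => (E i \ E (i+1)) \ V
  have hc : ∀ i j, i < j → Disjoint (c i) (c j) := by
    intro i j hij
    rw [Set.disjoint_left]
    intro k hi hj
    exact hi.1.2 (hanti hij hj.1.1)
  obtain ⟨N, hN1, hN2, hN3⟩ := lemQ c (fun i j hij => by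
    rcases lt_or_gt_of_ne hij with h | h
    · exact hc i j h
    · exact (hc j i h).symm)
  refine ⟨N, fun z hz => (hN1 z hz).1, hN2, ?_, ?_, ?_⟩
  · rintro z hz u ⟨hu, n, hun⟩
    obtain ⟨-, h2, h3⟩ := hN1 z hz
    have hz1 : AS z (E n) := by
      refine (Set.Finite.biUnion (Set.finite_lt_nat n) (fun i _ => h3 i)).subset ?_
      intro k hk
      obtain ⟨i, hi⟩ := Set.mem_iUnion.1 (h2 hk.1)
      refine Set.mem_biUnion (x := i) ?_ ⟨hk.1, hi⟩
      by_contra hle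
      exact hk.2 (hanti (not_lt.1 hle) hi.1.1)
    exact (hz1.trans (AS.of_subset (hEe n))).trans (hG _ _ hu (he n).1 hun)
  · intro z hz v hv hvC
    obtain ⟨-, h2, h3⟩ := hN1 z hz
    refine (hV1 v hv hvC).subset ?_
    intro k hk
    obtain ⟨i, hi⟩ := Set.mem_iUnion.1 (h2 hk.1)
    exact ⟨hk.2, hi.2⟩
  · intro y γ hγ hcut hinf
    refine hN3 y (Set.infinite_of_forall_exists_gt fun n0 => ?_)
    suffices h : ∀ n, ∃ b ∈ {i | (y ∩ c i).Infinite}, n ≤ b from h (n0 + 1)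
    intro n
    have h1 : e n ∈ cut r G e := ⟨(he n).1, n+1, (he n).2⟩
    rw [← hcut] at h1
    obtain ⟨-, k, hk⟩ := h1
    have h2 : γ (k+1) ∈ cut r G γ := ⟨(hγ (k+1)).1, k+2, (hγ (k+1)).2⟩
    rw [hcut] at h2
    obtain ⟨-, m, hm⟩ := h2
    have a1 : AS (γ k) (E n) := (hG _ _ (he n).1 (hγ k).1 hk).trans (heE n)
    have a2 : AS (e m) (γ (k+1)) := hG _ _ (hγ (k+1)).1 (he m).1 hm
    have a3 : AS V (γ (k+1)) := (hV2 m).trans a2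
    have a4 : AS (E m) (γ (k+1)) := (AS.of_subset (hEe m)).trans a2
    by_contra! hcon
    have hfin : ∀ i ≥ n, (y ∩ c i).Finite := by
      intro i hi
      by_contra hni
      exact absurd (hcon i hni) (not_lt.2 hi)
    have hF := (Set.Finite.union a1 a3).union (Set.Finite.union a4
      (Set.Finite.biUnion (Set.finite_Ico n m) (fun i hi => hfin i hi.1)))
    refine hinf k (hF.subset ?_)
    rintro j ⟨⟨hjy, hj1⟩, hj2⟩
    rcases Classical.em (j ∈ E n) with b1 | b1
    swap
    · exact Or.inl (Or.inl ⟨hj1, b1⟩)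
    rcases Classical.em (j ∈ V) with b2 | b2
    · exact Or.inl (Or.inr ⟨b2, hj2⟩)
    rcases Classical.em (j ∈ E m) with b3 | b3
    · exact Or.inr (Or.inl ⟨b3, hj2⟩)
    right; right
    obtain ⟨i, hni, him, hi1, hi2⟩ := last_col E hanti n m j b1 b3
    exact Set.mem_biUnion (x := i) ⟨hni, him⟩ ⟨hjy, ⟨hi1, hi2⟩, b2⟩

theorem tower (p : Ultrafilter ℕ) (hp : ∀ x ∈ p, x.Infinite) :
    ∃ (r : Set ℕ → Set ℕ → Prop) (_ : IsWellOrder (Set ℕ) r) (G : Set ℕ → Prop),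
      (∀ x, G x → x ∈ p) ∧ (∀ x y, G x → G y → r x y → AS y x) ∧
      ∀ v ∈ p, ∃ u, G u ∧ (v \ u).Infinite := by
  classical
  obtain ⟨r, wo, -⟩ := exists_order
  obtain ⟨G, hG⟩ := exists_rec r wo.wf
    (fun y (f : Set ℕ → Prop) (v : Prop) => v ↔ (y ∈ p ∧ ∀ x, r x y → f x → AS y x))
    (by
      intro y f g v hfg h
      refine h.trans (and_congr_right fun _ => forall_congr' fun x => ?_)
      constructor
      · intro h1 h2 h3; exact h1 h2 ((hfg x h2).symm ▸ h3)
      · intro h1 h2 h3; exact h1 h2 ((hfg x h2) ▸ h3))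
    (fun y f _ => ⟨_, Iff.rfl⟩)
  refine ⟨r, wo, G, fun x hx => ((hG x).1 hx).1, fun x y hx hy h => ((hG y).1 hy).2 x h hx, ?_⟩
  intro v hv
  by_contra! hcon
  have hsub : ∀ w ⊆ v, w ∈ p → G w := fun w hw hwp =>
    (hG w).2 ⟨hwp, fun x _ hx => (AS.of_subset hw).trans (hcon x hx)⟩
  have hpiece : ∃ w ∈ p, w ⊆ v ∧ (v \ w).Infinite := by
    obtain ⟨a, b, ha, hb, hab, hai, hbi⟩ := split v (hp v hv)
    by_cases h : a ∈ p
    · exact ⟨a, h, ha, hbi.mono fun k hk => ⟨hb hk, fun h => Set.disjoint_left.1 hab h hk⟩⟩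
    · refine ⟨v \ a, Filter.inter_mem hv (Ultrafilter.compl_mem_iff_notMem.2 h), fun k hk => hk.1, ?_⟩
      exact hai.mono fun k hk => ⟨ha hk, fun h => h.2 hk⟩
  obtain ⟨w, hw, hwv, hvw⟩ := hpiece
  exact hvw (hcon w (hsub w hwv hw))

theorem balcar_vojtas (p : Ultrafilter ℕ) (hp : ∀ x ∈ p, x.Infinite) :
    ∃ N : Set (Set ℕ), (∀ z ∈ N, z.Infinite) ∧
      (∀ z ∈ N, ∀ z' ∈ N, z ≠ z' → (z ∩ z').Finite) ∧ ∀ x ∈ p, ∃ z ∈ N, z ⊆ x := by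
  classical
  obtain ⟨r, wo, G, hGp, hG, hGv⟩ := tower p hp
  choose NC h1 h2 h3 h4 h5 using lemCut r wo G hG
  refine ⟨{z | ∃ C hC, z ∈ NC C hC}, ?_, ?_, ?_⟩
  · rintro z ⟨C, hC, hz⟩; exact h1 C hC z hz
  · have aux : ∀ C hC C' hC' z z', z ∈ NC C hC → z' ∈ NC C' hC' → ¬ C' ⊆ C → (z ∩ z').Finite := by
      intro C hC C' hC' z z' hz hz' hsub
      obtain ⟨v, hv', hv⟩ := Set.not_subset.1 hsub
      have hGv : G v := by
        obtain ⟨e, -, rfl⟩ := hC'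
        exact hv'.1
      have a1 := h3 C' hC' z' hz' v hv'
      have a2 := h4 C hC z hz v hGv hv
      refine (Set.Finite.union a1 a2).subset ?_
      intro k hk
      by_cases h : k ∈ v
      · exact Or.inr ⟨hk.1, h⟩
      · exact Or.inl ⟨hk.2, h⟩
    rintro z ⟨C, hC, hz⟩ z' ⟨C', hC', hz'⟩ hne
    by_cases hs : C' ⊆ C
    · by_cases hs' : C ⊆ C'
      · obtain rfl := hs.antisymm hs'
        exact h2 _ hC z hz z' hz' hne
      · rw [Set.inter_comm]; exact aux C' hC' C hC z' z hz' hz hs'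
    · exact aux C hC C' hC' z z' hz hz' hs
  · intro y hy
    choose! U hU1 hU2 using hGv
    let γ : ℕ → Set ℕ := fun n => Nat.rec (U y) (fun _ x => U (y ∩ x)) n
    have γs : ∀ n, γ (n+1) = U (y ∩ γ n) := fun n => rfl
    have hγ : ∀ n, G (γ n) := by
      intro n
      induction n with
      | zero => exact hU1 y hy
      | succ n ih => rw [γs]; exact hU1 _ (Filter.inter_mem hy (hGp _ ih))
    have hinf : ∀ n, ((y ∩ γ n) \ γ (n+1)).Infinite := fun n => by
      rw [γs]; exact hU2 _ (Filter.inter_mem hy (hGp _ (hγ n)))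
    have hch : Chain r G γ := by
      intro n
      refine ⟨hγ n, ?_⟩
      have hbad : ¬ AS (γ n) (γ (n+1)) := fun h =>
        hinf n (Set.Finite.subset h fun k hk => ⟨hk.1.2, hk.2⟩)
      rcases trichotomous_of r (γ n) (γ (n+1)) with h | h | h
      · exact h
      · exact absurd (AS.of_subset h.subset) hbad
      · exact absurd (hG _ _ (hγ (n+1)) (hγ n) h) hbad
    obtain ⟨z, hz, hzy⟩ := h5 (cut r G γ) ⟨γ, hch, rfl⟩ y γ hch rfl hinf
    exact ⟨z, ⟨_, _, hz⟩, hzy⟩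

theorem nbhd (p : OmegaStar) (W : Set OmegaStar) (hW : IsOpen W) (hp : p ∈ W) :
    ∃ x ∈ p.1, {q : OmegaStar | x ∈ q.1} ⊆ W := by
  have hW' : TopologicalSpace.GenerateOpen
    {S | ∃ x : Set ℕ, S = {q : OmegaStar | x ∈ q.1}} W := hW
  clear hW
  induction hW' with
  | basic s hs =>
    obtain ⟨x, rfl⟩ := hs
    exact ⟨x, hp, subset_rfl⟩
  | univ => exact ⟨Set.univ, Filter.univ_mem, Set.subset_univ _⟩
  | inter s t _ _ hs ht =>
    obtain ⟨x, hx, hxs⟩ := hs hp.1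
    obtain ⟨y, hy, hyt⟩ := ht hp.2
    refine ⟨x ∩ y, Filter.inter_mem hx hy, fun q hq => ⟨hxs ?_, hyt ?_⟩⟩
    · exact Filter.mem_of_superset hq Set.inter_subset_left
    · exact Filter.mem_of_superset hq Set.inter_subset_right
  | sUnion S _ ih =>
    obtain ⟨s, hs, hps⟩ := hp
    obtain ⟨x, hx, hxs⟩ := ih s hs hps
    exact ⟨x, hx, hxs.trans (Set.subset_sUnion_of_mem hs)⟩

theorem star_nonempty (z : Set ℕ) (hz : z.Infinite) : {q : OmegaStar | z ∈ q.1}.Nonempty := by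
  have hne : (Filter.cofinite ⊓ Filter.principal z).NeBot :=
    Filter.cofinite_inf_principal_neBot_iff.2 hz
  let q := Ultrafilter.of (Filter.cofinite ⊓ Filter.principal z)
  have hq : (q : Filter ℕ) ≤ Filter.cofinite ⊓ Filter.principal z := Ultrafilter.of_le _
  refine ⟨⟨q, fun x hx hfin => ?_⟩, ?_⟩
  · have h1 : xᶜ ∈ q := hq (Filter.mem_inf_of_left hfin.compl_mem_cofinite)
    exact Ultrafilter.compl_mem_iff_notMem.1 h1 hx
  · exact hq (Filter.mem_inf_of_right (Filter.mem_principal_self z))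

end BV

/-- Every point of `ω*` has a pairwise disjoint (hence `ω^op`-like) local π-base;
so the local Noetherian π-type of `ω*` is `ω`. -/
theorem omegaStar_pairwiseDisjoint_local_pi_base :
    ∀ p : OmegaStar, ∃ B : Set (Set OmegaStar), IsLocalPiBase p B ∧
      (∀ U ∈ B, ∀ V ∈ B, U ≠ V → U ∩ V = ∅) ∧ IsOpLike B ℵ₀ := by
  intro p
  obtain ⟨N, hN1, hN2, hN3⟩ := BV.balcar_vojtas p.1 p.2
  have hdisj : ∀ U ∈ {S : Set OmegaStar | ∃ z ∈ N, S = {q : OmegaStar | z ∈ q.1}},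
      ∀ V ∈ {S : Set OmegaStar | ∃ z ∈ N, S = {q : OmegaStar | z ∈ q.1}},
      U ≠ V → U ∩ V = ∅ := by
    rintro _ ⟨z, hz, rfl⟩ _ ⟨z', hz', rfl⟩ hne
    rw [Set.eq_empty_iff_forall_notMem]
    rintro q ⟨hq1, hq2⟩
    refine q.2 _ (Filter.inter_mem hq1 hq2) (hN2 z hz z' hz' ?_)
    rintro rfl
    exact hne rfl
  have hnon : ∀ U ∈ {S : Set OmegaStar | ∃ z ∈ N, S = {q : OmegaStar | z ∈ q.1}}, U.Nonempty := by
    rintro _ ⟨z, hz, rfl⟩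
    exact BV.star_nonempty z (hN1 z hz)
  refine ⟨{S | ∃ z ∈ N, S = {q : OmegaStar | z ∈ q.1}}, ⟨fun U hU => ⟨?_, hnon U hU⟩, ?_⟩, hdisj, ?_⟩
  · obtain ⟨z, hz, rfl⟩ := hU
    exact TopologicalSpace.isOpen_generateFrom_of_mem ⟨z, rfl⟩
  · intro W hW hpW
    obtain ⟨x, hx, hxW⟩ := BV.nbhd p W hW hpW
    obtain ⟨z, hz, hzx⟩ := hN3 x hx
    exact ⟨_, ⟨z, hz, rfl⟩, fun q hq => hxW (Filter.mem_of_superset hq hzx)⟩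
  · intro U hU
    have hsub : Subsingleton {V : Set OmegaStar //
        V ∈ {S : Set OmegaStar | ∃ z ∈ N, S = {q : OmegaStar | z ∈ q.1}} ∧ U ⊆ V} := by
      have key : ∀ V ∈ {S : Set OmegaStar | ∃ z ∈ N, S = {q : OmegaStar | z ∈ q.1}},
          U ⊆ V → V = U := by
        intro V hV hUV
        by_contra hne
        obtain ⟨q, hq⟩ := hnon U hU
        have := hdisj V hV U hU hne
        exact (Set.eq_empty_iff_forall_notMem.1 this) q ⟨hUV hq, hq⟩
      refine ⟨fun V V' => Subtype.ext ?_⟩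
      rw [key V.1 V.2.1 V.2.2, key V'.1 V'.2.1 V'.2.2]
    exact Cardinal.lt_aleph0_of_finite _
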